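/- In the partition algebra A_k(z): for every i with 1 ≤ i ≤ k−1 one has p_{i+1} σ_{i+1} p_{i+1} = L_i p_{i+1} and p_{i+1} σ_{i+1/2} p_{i+1} = (z·1 − L_{i−1/2}) p_{i+1}; and for every i with 1 ≤ i ≤ k−2 one has p_{i+3/2} σ_{i+1} p_{i+3/2} = p_{i+1/2} p_{i+3/2}. -/

import Mathlib

open Polynomial

/-- Elements of an algebra over `R = ℤ[z]` (with `z = Polynomial.X`) satisfying the
defining relations of the partition algebra `A_k(z)` of Halverson–Ram.
Here `p i` stands for the generator `p_i` (for `1 ≤ i ≤ k`), `q i` stands for the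
half-integer generator `p_{i+1/2}` (for `1 ≤ i ≤ k-1`), and `s i` stands for `s_i`
(for `1 ≤ i ≤ k-1`). -/
structure PartitionAlgebra (k : ℕ) (A : Type*) [Ring A] [Algebra (Polynomial ℤ) A] where
  p : ℕ → A
  q : ℕ → A
  s : ℕ → A
  s_sq : ∀ i, 1 ≤ i → i ≤ k - 1 → s i * s i = 1
  s_comm : ∀ i j, 1 ≤ i → i ≤ k - 1 → 1 ≤ j → j ≤ k - 1 → j ≠ i + 1 → i ≠ j + 1 →
    s i * s j = s j * s i
  braid : ∀ i, 1 ≤ i → i + 1 ≤ k - 1 →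
    s i * s (i + 1) * s i = s (i + 1) * s i * s (i + 1)
  p_sq : ∀ i, 1 ≤ i → i ≤ k → p i * p i = (X : Polynomial ℤ) • p i
  q_sq : ∀ i, 1 ≤ i → i ≤ k - 1 → q i * q i = q i
  s_q : ∀ i, 1 ≤ i → i ≤ k - 1 → s i * q i = q i
  q_s : ∀ i, 1 ≤ i → i ≤ k - 1 → q i * s i = q i
  s_pp : ∀ i, 1 ≤ i → i ≤ k - 1 → s i * (p i * p (i + 1)) = p i * p (i + 1)
  pp_s : ∀ i, 1 ≤ i → i ≤ k - 1 → p i * p (i + 1) * s i = p i * p (i + 1)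
  p_comm : ∀ i j, 1 ≤ i → i ≤ k → 1 ≤ j → j ≤ k → p i * p j = p j * p i
  q_comm : ∀ i j, 1 ≤ i → i ≤ k - 1 → 1 ≤ j → j ≤ k - 1 → q i * q j = q j * q i
  q_p : ∀ i j, 1 ≤ i → i ≤ k - 1 → 1 ≤ j → j ≤ k → j ≠ i → j ≠ i + 1 →
    q i * p j = p j * q i
  s_p : ∀ i j, 1 ≤ i → i ≤ k - 1 → 1 ≤ j → j ≤ k → j ≠ i → j ≠ i + 1 →
    s i * p j = p j * s i
  s_q' : ∀ i j, 1 ≤ i → i ≤ k - 1 → 1 ≤ j → j ≤ k - 1 → j + 1 ≠ i → j ≠ i + 1 →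
    s i * q j = q j * s i
  sps : ∀ i, 1 ≤ i → i ≤ k - 1 → s i * p i * s i = p (i + 1)
  sqs : ∀ i, 2 ≤ i → i ≤ k - 1 →
    s i * q (i - 1) * s i = s (i - 1) * q i * s (i - 1)
  qpq₁ : ∀ i, 1 ≤ i → i ≤ k - 1 → q i * p i * q i = q i
  qpq₂ : ∀ i, 1 ≤ i → i ≤ k - 1 → q i * p (i + 1) * q i = q i
  pqp₁ : ∀ i, 2 ≤ i → i ≤ k → p i * q (i - 1) * p i = p i
  pqp₂ : ∀ i, 1 ≤ i → i ≤ k - 1 → p i * q i * p i = p i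

namespace PartitionAlgebra

variable {k : ℕ} {A : Type*} [Ring A] [Algebra (Polynomial ℤ) A]

/-- `(P.LS i).1 = L_i` and `(P.LS i).2 = σ_i` (with the junk value `σ_0 := 1`). -/
def LS (P : PartitionAlgebra k A) : ℕ → A × A
  | 0 => (0, 1)
  | 1 => (P.p 1, 1)
  | n + 2 =>
    let Lp := (P.LS (n + 1)).1
    let sp := (P.LS (n + 1)).2
    let Lpp := (P.LS n).1
    let snew : A :=
      if n = 0 then P.s 1
      else
        P.s n * P.s (n + 1) * sp * P.s (n + 1) * P.s n
          + P.s (n + 1) * P.q n * Lpp * P.s (n + 1) * P.q n * P.s (n + 1)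
          + P.q n * Lpp * P.s (n + 1) * P.q n
          - P.s (n + 1) * P.q n * Lpp * P.s n * P.q (n + 1) * P.p (n + 1) * P.q n
          - P.q n * P.p (n + 1) * P.q (n + 1) * P.s n * Lpp * P.q n * P.s (n + 1)
    (-(P.s (n + 1) * Lp * P.q (n + 1)) - P.q (n + 1) * Lp * P.s (n + 1)
        + P.q (n + 1) * Lp * P.p (n + 2) * P.q (n + 1)
        + P.s (n + 1) * Lp * P.s (n + 1) + snew,
      snew)

/-- The Jucys–Murphy element `L_i` of the partition algebra. -/
def L (P : PartitionAlgebra k A) (i : ℕ) : A := (P.LS i).1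

/-- The element `σ_i` of the partition algebra. -/
def sig (P : PartitionAlgebra k A) (i : ℕ) : A := (P.LS i).2

/-- `(P.LSh i).1 = L_{i+1/2}` and `(P.LSh i).2 = σ_{i+1/2}`. -/
def LSh (P : PartitionAlgebra k A) : ℕ → A × A
  | 0 => (0, 1)
  | 1 =>
    (-(P.L 1 * P.q 1) - P.q 1 * P.L 1 + P.q 1 * P.L 1 * P.p 1 * P.q 1
        + P.s 1 * (0 : A) * P.s 1 + 1, 1)
  | n + 2 =>
    let Lhp := (P.LSh (n + 1)).1
    let shp := (P.LSh (n + 1)).2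
    let snew : A :=
      P.s (n + 1) * P.s (n + 2) * shp * P.s (n + 2) * P.s (n + 1)
        + P.q (n + 1) * P.L (n + 1) * P.s (n + 2) * P.q (n + 1) * P.s (n + 2)
        + P.s (n + 2) * P.q (n + 1) * P.L (n + 1) * P.s (n + 2) * P.q (n + 1)
        - P.q (n + 1) * P.L (n + 1) * P.s (n + 1) * P.q (n + 2) * P.p (n + 2) * P.q (n + 1)
        - P.s (n + 2) * P.q (n + 1) * P.p (n + 2) * P.q (n + 2) * P.s (n + 1)
            * P.L (n + 1) * P.q (n + 1) * P.s (n + 2)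
    (-(P.L (n + 2) * P.q (n + 2)) - P.q (n + 2) * P.L (n + 2)
        + P.q (n + 2) * P.L (n + 2) * P.p (n + 2) * P.q (n + 2)
        + P.s (n + 2) * Lhp * P.s (n + 2) + snew,
      snew)

/-- The half-integer Jucys–Murphy element `L_{i+1/2}` of the partition algebra. -/
def Lh (P : PartitionAlgebra k A) (i : ℕ) : A := (P.LSh i).1

/-- The element `σ_{i+1/2}` of the partition algebra. -/
def sigH (P : PartitionAlgebra k A) (i : ℕ) : A := (P.LSh i).2

end PartitionAlgebra

section Words

variable {A : Type*} [Ring A]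

theorem Eq.reassoc {x y z : A} (h : x * y = z) (w : A) : x * (y * w) = z * w := by
  rw [← mul_assoc, h]

theorem Eq.reassoc₃ {x y v z : A} (h : x * y * v = z) (w : A) :
    x * (y * (v * w)) = z * w := by
  rw [← mul_assoc, ← mul_assoc, h]

theorem Eq.reassoc₄ {x y v t z : A} (h : x * y * v * t = z) (w : A) :
    x * (y * (v * (t * w))) = z * w := by
  rw [← h]; simp only [mul_assoc]

theorem eq_of_forall_mul_eq {x y : A} (h : ∀ w, x * w = y * w) : x = y := by
  simpa using h 1

/-- The relations among the generators of a partition algebra supported on three consecutive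
strands: `s`, `t` are the transpositions, `a`, `b` the half-integer generators, and `r`, `p`, `u`
the integer generators. -/
structure ThreeStrand (s t a b r p u : A) : Prop where
  ss : s * s = 1
  tt : t * t = 1
  sts : s * t * s = t * s * t
  sa : s * a = a
  as : a * s = a
  tb : t * b = b
  bt : b * t = b
  ba : b * a = a * b
  sr : s * r = p * s
  sp : s * p = r * s
  tp : t * p = u * t
  tu : t * u = p * t
  tr : t * r = r * t
  us : u * s = s * u
  ua : u * a = a * u
  up : u * p = p * u
  br : b * r = r * b
  tpu : t * p * u = p * u
  tat : t * a * t = s * b * s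
  apa : a * p * a = a
  bpb : b * p * b = b
  pap : p * a * p = p
  pbp : p * b * p = p
  ubu : u * b * u = u

namespace ThreeStrand

variable {s t a b r p u : A}

theorem tsb (W : ThreeStrand s t a b r p u) : t * s * b = a * t * s := by
  calc t * s * b = t * (s * b * s) * s := by
        refine eq_of_forall_mul_eq fun w => ?_
        simp only [mul_assoc, W.ss.reassoc, one_mul]
    _ = a * t * s := by
        rw [← W.tat]
        refine eq_of_forall_mul_eq fun w => ?_
        simp only [mul_assoc, W.tt.reassoc, one_mul]

theorem bst (W : ThreeStrand s t a b r p u) : b * s * t = s * t * a := by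
  calc b * s * t = s * (s * b * s) * t := by
        refine eq_of_forall_mul_eq fun w => ?_
        simp only [mul_assoc, W.ss.reassoc, one_mul]
    _ = s * t * a := by
        rw [← W.tat]
        refine eq_of_forall_mul_eq fun w => ?_
        simp only [mul_assoc, W.tt.reassoc, one_mul]

theorem bsb (W : ThreeStrand s t a b r p u) : b * s * b = a * b := by
  calc b * s * b = s * (s * b * s) * b := by
        refine eq_of_forall_mul_eq fun w => ?_
        simp only [mul_assoc, W.ss.reassoc, one_mul]
    _ = a * b := by
        rw [← W.tat]
        refine eq_of_forall_mul_eq fun w => ?_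
        simp only [mul_assoc, W.tb.reassoc, W.ba.symm.reassoc]
        simp only [mul_assoc, W.ba.reassoc, W.sa.reassoc]

theorem utu (W : ThreeStrand s t a b r p u) : u * t * u = p * u := by
  rw [← W.tp, W.tpu]

theorem pbu (W : ThreeStrand s t a b r p u) : p * b * u = p * t := by
  calc p * b * u = p * b * (t * t * u) := by rw [W.tt, one_mul]
    _ = p * (b * t) * (t * u) := by simp only [mul_assoc]
    _ = p * b * p * t := by rw [W.bt, W.tu]; simp only [mul_assoc]
    _ = p * t := by rw [W.pbp]

theorem ubp (W : ThreeStrand s t a b r p u) : u * b * p = t * p := by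
  calc u * b * p = u * t * t * b * p := by rw [mul_assoc u t t, W.tt, mul_one]
    _ = t * (p * (t * b) * p) := by rw [← W.tp]; simp only [mul_assoc]
    _ = t * p := by rw [W.tb, W.pbp]

theorem bub (W : ThreeStrand s t a b r p u) : b * u * b = b := by
  calc b * u * b = b * (t * p * t) * b := by rw [W.tp, mul_assoc u, W.tt, mul_one]
    _ = (b * t) * p * (t * b) := by simp only [mul_assoc]
    _ = b := by rw [W.tb, W.bt, W.bpb]

end ThreeStrand

/-- A pair `L`, `τ` satisfying the relations which, for consecutive strands `j`, `j + 1`, `j + 2`,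
hold for the Jucys–Murphy element `L_j` and `σ_{j+1/2}`. -/
structure MurphyPair (s t a b r p u L τ : A) : Prop extends ThreeStrand s t a b r p u where
  tL : t * L = L * t
  bL : b * L = L * b
  pL : p * L = L * p
  uL : u * L = L * u
  uτ : u * τ = τ * u
  sτ : s * τ = τ * s
  bτ : b * τ = τ * b
  La : L * a = τ * r * a
  aL : a * L = a * r * τ
  aτ : a * τ = a
  τa : τ * a = a

/-- The recursive expression for `σ_{j+3/2}`. -/
def nextTau (s t a b p L τ : A) : A :=
  s * t * τ * t * s + a * L * t * a * t + t * a * L * t * a - a * L * s * b * p * a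
    - t * a * p * b * s * L * a * t

/-- The recursive expression for `L_{j+1}`. -/
def nextL (s a p L τ : A) : A :=
  -(s * L * a) - a * L * s + a * L * p * a + s * L * s + s * τ

namespace MurphyPair

variable {s t a b r p u L τ : A}

theorem a_L_sbpa (W : MurphyPair s t a b r p u L τ) :
    a * L * s * b * p * a = a * p * b * s * L * a := by
  trans a * p * τ * b * p * a
  · refine eq_of_forall_mul_eq fun w => ?_
    simp only [mul_assoc, W.aL.reassoc, W.sτ.symm.reassoc]
    simp only [mul_assoc, W.sp.symm.reassoc, W.as.reassoc]
  · refine eq_of_forall_mul_eq fun w => ?_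
    simp only [mul_assoc, W.La.reassoc, W.sτ.reassoc, W.bτ.reassoc, W.sr.reassoc, W.sa.reassoc]

theorem pbsLap (W : MurphyPair s t a b r p u L τ) :
    p * b * s * L * a * p = t * τ * t * p := by
  trans p * τ * b * p
  · refine eq_of_forall_mul_eq fun w => ?_
    simp only [mul_assoc, W.La.reassoc, W.sτ.reassoc, W.bτ.reassoc, W.sr.reassoc, W.sa.reassoc,
      W.pap.reassoc₃]
  trans p * t * τ * t * b * p
  · refine eq_of_forall_mul_eq fun w => ?_
    simp only [mul_assoc, W.tb.reassoc, W.bτ.symm.reassoc]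
  · refine eq_of_forall_mul_eq fun w => ?_
    simp only [mul_assoc, W.tu.symm.reassoc, W.uτ.reassoc]
    simp only [mul_assoc, W.tp.symm.reassoc, W.pbp.reassoc₃]

theorem t_mul_nextTau (W : MurphyPair s t a b r p u L τ) :
    t * nextTau s t a b p L τ = nextTau s t a b p L τ * t := by
  have h₁ : t * (s * t * τ * t * s) = s * t * τ * t * s * t := by
    refine eq_of_forall_mul_eq fun w => ?_
    simp only [mul_assoc, W.sts.symm.reassoc₃, W.sτ.reassoc]
  have h₂ : t * (a * L * t * a * t) = t * a * L * t * a * t := by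
    refine eq_of_forall_mul_eq fun w => ?_
    simp only [mul_assoc]
  have h₃ : t * (t * a * L * t * a) = a * L * t * a * t * t := by
    refine eq_of_forall_mul_eq fun w => ?_
    simp only [mul_assoc, W.tt.reassoc, one_mul]
  have h₄ : t * (a * L * s * b * p * a) = t * a * p * b * s * L * a * t * t := by
    rw [W.a_L_sbpa]
    refine eq_of_forall_mul_eq fun w => ?_
    simp only [mul_assoc, W.tt.reassoc, one_mul]
  have h₅ : t * (t * a * p * b * s * L * a * t) = a * L * s * b * p * a * t := by
    rw [W.a_L_sbpa]
    refine eq_of_forall_mul_eq fun w => ?_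
    simp only [mul_assoc, W.tt.reassoc, one_mul]
  simp only [nextTau, mul_add, mul_sub, add_mul, sub_mul]
  rw [h₁, h₂, h₃, h₄, h₅]
  abel

theorem b_mul_nextTau (W : MurphyPair s t a b r p u L τ) :
    b * nextTau s t a b p L τ = b := by
  have h₁ : b * (s * t * τ * t * s) = b := by
    refine eq_of_forall_mul_eq fun w => ?_
    simp only [mul_assoc, W.bst.reassoc₃, W.aτ.reassoc, W.tat.reassoc₃]
    simp only [W.ss.reassoc, one_mul]
  have h₂ : b * (a * L * t * a * t) = a * L * a * b := by
    refine eq_of_forall_mul_eq fun w => ?_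
    simp only [mul_assoc, W.ba.reassoc, W.bL.reassoc, W.bt.reassoc]
  have h₃ : b * (t * a * L * t * a) = a * L * a * b := by
    refine eq_of_forall_mul_eq fun w => ?_
    simp only [mul_assoc, W.ba.reassoc, W.bL.reassoc, W.bt.reassoc]
  have h₄ : b * (a * L * s * b * p * a) = a * L * a * b := by
    refine eq_of_forall_mul_eq fun w => ?_
    simp only [mul_assoc, W.ba.reassoc, W.bL.reassoc, W.bsb.reassoc₃]
    simp only [mul_assoc, W.ba.symm.reassoc]
    simp only [W.apa.reassoc₃]
  have h₅ : b * (t * a * p * b * s * L * a * t) = a * L * a * b := by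
    refine eq_of_forall_mul_eq fun w => ?_
    simp only [mul_assoc, W.ba.reassoc, W.bt.reassoc, W.bpb.reassoc₃]
    simp only [mul_assoc, W.ba.symm.reassoc, W.as.reassoc]
    simp only [mul_assoc, W.ba.reassoc, W.bL.reassoc, W.bt.reassoc]
  simp only [nextTau, mul_add, mul_sub]
  rw [h₁, h₂, h₃, h₄, h₅]
  abel

theorem nextTau_mul_b (W : MurphyPair s t a b r p u L τ) :
    nextTau s t a b p L τ * b = b := by
  have h₁ : s * t * τ * t * s * b = b := by
    refine eq_of_forall_mul_eq fun w => ?_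
    simp only [mul_assoc, W.tsb.reassoc₃, W.τa.reassoc, W.tat.reassoc₃]
    simp only [W.ss.reassoc, one_mul]
  have h₂ : a * L * t * a * t * b = a * L * a * b := by
    refine eq_of_forall_mul_eq fun w => ?_
    simp only [mul_assoc, W.tb.reassoc, W.ba.symm.reassoc]
  have h₃ : t * a * L * t * a * b = a * L * a * b := by
    refine eq_of_forall_mul_eq fun w => ?_
    simp only [mul_assoc, W.tb.reassoc, W.ba.symm.reassoc, W.bL.symm.reassoc]
  have h₄ : a * L * s * b * p * a * b = a * L * a * b := by
    refine eq_of_forall_mul_eq fun w => ?_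
    simp only [mul_assoc, W.ba.symm.reassoc, W.bpb.reassoc₃]
    simp only [mul_assoc, W.ba.reassoc, W.sa.reassoc]
  have h₅ : t * a * p * b * s * L * a * t * b = a * L * a * b := by
    refine eq_of_forall_mul_eq fun w => ?_
    simp only [mul_assoc, W.tb.reassoc, W.ba.symm.reassoc, W.bL.symm.reassoc]
    simp only [mul_assoc, W.bsb.reassoc₃, W.apa.reassoc₃]
    simp only [mul_assoc, W.ba.symm.reassoc, W.tb.reassoc]
  simp only [nextTau, add_mul, sub_mul]
  rw [h₁, h₂, h₃, h₄, h₅]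
  abel

theorem nextL_mul_b (W : MurphyPair s t a b r p u L τ) :
    nextL s a p L τ * b = nextTau s t a b p L τ * p * b := by
  have h₁ : s * t * τ * t * s * p * b = s * L * s * b := by
    refine eq_of_forall_mul_eq fun w => ?_
    simp only [mul_assoc, W.sp.reassoc, W.tr.reassoc, W.tsb.reassoc₃, W.La.symm.reassoc₃,
      W.tL.reassoc, W.tat.reassoc₃]
    simp only [W.ss.reassoc, one_mul]
  have h₂ : a * L * t * a * t * p * b = a * L * p * a * b := by
    refine eq_of_forall_mul_eq fun w => ?_
    simp only [mul_assoc, W.tat.reassoc₃, W.sp.reassoc, W.sr.reassoc, W.br.reassoc, W.bsb.reassoc₃,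
      W.sa.reassoc]
  have h₃ : t * a * L * t * a * p * b = s * τ * b := by
    refine eq_of_forall_mul_eq fun w => ?_
    simp only [mul_assoc, W.tL.symm.reassoc, W.tat.reassoc₃]
    simp only [mul_assoc, W.La.reassoc, W.sτ.reassoc, W.bτ.reassoc, W.sr.reassoc, W.sa.reassoc,
      W.pap.reassoc₃, W.bpb.reassoc₃]
  have h₄ : a * L * s * b * p * a * p * b = a * L * s * b := by
    refine eq_of_forall_mul_eq fun w => ?_
    simp only [mul_assoc, W.pap.reassoc₃, W.bpb.reassoc₃]
  have h₅ : t * a * p * b * s * L * a * t * p * b = s * L * a * b := by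
    refine eq_of_forall_mul_eq fun w => ?_
    simp only [mul_assoc, W.tp.reassoc, W.tb.reassoc, W.ua.symm.reassoc, W.uL.symm.reassoc,
      W.us.symm.reassoc, W.pbu.reassoc₃]
    simp only [mul_assoc, W.tu.symm.reassoc, W.us.reassoc, W.tat.reassoc₃, W.ss.reassoc, one_mul]
    simp only [mul_assoc, W.ba.symm.reassoc, W.bL.symm.reassoc, W.bub.reassoc₃]
  simp only [nextL, nextTau, add_mul, sub_mul, neg_mul]
  rw [h₁, h₂, h₃, h₄, h₅]
  abel

theorem b_mul_nextL (W : MurphyPair s t a b r p u L τ) :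
    b * nextL s a p L τ = b * p * nextTau s t a b p L τ := by
  have h_sym : t * a * p * b * s * L * a * t = t * (a * L * s * b * p * a) * t := by
    rw [W.a_L_sbpa]; simp only [mul_assoc]
  have h₁ : b * p * (s * t * τ * t * s) = b * (s * L * s) := by
    refine eq_of_forall_mul_eq fun w => ?_
    simp only [mul_assoc, W.sr.symm.reassoc, W.tr.symm.reassoc, W.bst.reassoc₃, W.aL.symm.reassoc₃,
      W.tL.symm.reassoc, W.tat.reassoc₃]
    simp only [W.ss.reassoc, one_mul]
  have h₂ : b * p * (a * L * t * a * t) = b * (s * τ) := by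
    refine eq_of_forall_mul_eq fun w => ?_
    simp only [mul_assoc, W.tat.reassoc₃]
    simp only [mul_assoc, W.aL.reassoc, W.sτ.symm.reassoc, W.sp.symm.reassoc, W.as.reassoc,
      W.bτ.symm.reassoc, W.pap.reassoc₃, W.bpb.reassoc₃]
  have h₃ : b * p * (t * a * L * t * a) = b * (a * L * p * a) := by
    refine eq_of_forall_mul_eq fun w => ?_
    simp only [mul_assoc, W.tL.symm.reassoc, W.tat.reassoc₃, W.sr.symm.reassoc, W.br.symm.reassoc,
      W.sp.symm.reassoc, W.bsb.reassoc₃, W.pL.symm.reassoc]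
    simp only [mul_assoc, W.ba.symm.reassoc, W.as.reassoc]
  have h₄ : b * p * (a * L * s * b * p * a) = b * (s * L * a) := by
    rw [W.a_L_sbpa]
    refine eq_of_forall_mul_eq fun w => ?_
    simp only [mul_assoc, W.pap.reassoc₃, W.bpb.reassoc₃]
  have h₅ : b * p * (t * a * p * b * s * L * a * t) = b * (a * L * s) := by
    rw [h_sym]
    refine eq_of_forall_mul_eq fun w => ?_
    simp only [mul_assoc, W.tu.symm.reassoc, W.bt.reassoc, W.ua.reassoc, W.uL.reassoc, W.us.reassoc,
      W.ubp.reassoc₃, W.tp.reassoc]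
    simp only [mul_assoc, W.tat.reassoc₃, W.us.reassoc, W.ss.reassoc, one_mul]
    simp only [mul_assoc, W.ba.reassoc, W.bL.reassoc, W.bub.reassoc₃]
  simp only [nextL, nextTau, mul_add, mul_sub, mul_neg]
  rw [h₁, h₂, h₃, h₄, h₅]
  abel

theorem a_t_tau_t (W : MurphyPair s t a b r p u L τ) : a * t * τ * t = t * τ * t * a := by
  have h_comm : t * a * t * τ = τ * (t * a * t) := by
    rw [W.tat]
    refine eq_of_forall_mul_eq fun w => ?_
    simp only [mul_assoc, W.sτ.reassoc, W.bτ.reassoc]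
  trans t * (t * a * t * τ) * t
  · refine eq_of_forall_mul_eq fun w => ?_
    simp only [mul_assoc, W.tt.reassoc, one_mul]
  · rw [h_comm]
    refine eq_of_forall_mul_eq fun w => ?_
    simp only [mul_assoc, W.tt.reassoc, one_mul]

theorem paLtap (W : MurphyPair s t a b r p u L τ) :
    p * a * L * t * a * p = t * s * τ * t * p := by
  have h_core : p * a * r * t * a * p = t * s * t * p := by
    trans p * t * (t * a * t) * r * a * p
    · refine eq_of_forall_mul_eq fun w => ?_
      simp only [mul_assoc, W.tt.reassoc, one_mul, W.tr.reassoc]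
    · rw [W.tat]
      refine eq_of_forall_mul_eq fun w => ?_
      simp only [mul_assoc, W.sr.reassoc, W.sa.reassoc, W.tu.symm.reassoc, W.us.reassoc,
        W.ubp.reassoc₃, W.pap.reassoc₃]
  trans p * a * r * t * (t * τ * t * a) * p
  · refine eq_of_forall_mul_eq fun w => ?_
    simp only [mul_assoc, W.aL.reassoc, W.tt.reassoc, one_mul]
  trans p * a * r * t * a * p * t * τ * t
  · rw [← W.a_t_tau_t]
    refine eq_of_forall_mul_eq fun w => ?_
    simp only [mul_assoc, W.tp.reassoc, W.uτ.symm.reassoc, W.tu.reassoc]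
  · rw [h_core]
    refine eq_of_forall_mul_eq fun w => ?_
    simp only [mul_assoc, W.tu.symm.reassoc, W.tt.reassoc, one_mul, W.uτ.reassoc, W.tp.symm.reassoc]

theorem u_t_nextTau_u (W : MurphyPair s t a b r p u L τ) (h : p * s * τ * p = L * p) :
    u * (t * nextTau s t a b p L τ) * u = nextL s a p L τ * u := by
  have h_sym : t * a * p * b * s * L * a * t = t * (a * L * s * b * p * a) * t := by
    rw [W.a_L_sbpa]; simp only [mul_assoc]
  have h_core : u * t * a * r * s * b * u = u := by
    refine eq_of_forall_mul_eq fun w => ?_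
    simp only [mul_assoc, W.sp.symm.reassoc, W.as.reassoc, W.pbu.reassoc₃, W.tp.symm.reassoc,
      W.pap.reassoc₃]
    simp only [mul_assoc, W.tp.reassoc, W.tt.reassoc, one_mul]
  have h₁ : u * (t * (s * t * τ * t * s)) * u = s * L * s * u := by
    trans s * u * t * s * τ * t * u * s
    · refine eq_of_forall_mul_eq fun w => ?_
      simp only [mul_assoc, W.sts.symm.reassoc₃, W.us.reassoc]
    · refine eq_of_forall_mul_eq fun w => ?_
      simp only [mul_assoc, W.tp.symm.reassoc, W.tu.reassoc, h.reassoc₄]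
      simp only [mul_assoc, W.tL.reassoc, W.tp.reassoc, W.us.reassoc, W.tt.reassoc, one_mul]
  have h₂ : u * (t * (a * L * t * a * t)) * u = s * τ * u := by
    trans t * (p * a * L * t * a * p) * t
    · refine eq_of_forall_mul_eq fun w => ?_
      simp only [mul_assoc, W.tp.symm.reassoc, W.tu.reassoc]
    · rw [W.paLtap]
      refine eq_of_forall_mul_eq fun w => ?_
      simp only [mul_assoc, W.tt.reassoc, one_mul, W.tp.reassoc]
  have h₃ : u * (t * (t * a * L * t * a)) * u = a * L * p * a * u := by
    trans a * L * u * t * u * a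
    · refine eq_of_forall_mul_eq fun w => ?_
      simp only [mul_assoc, W.tt.reassoc, one_mul, W.ua.reassoc, W.uL.reassoc]
    · refine eq_of_forall_mul_eq fun w => ?_
      simp only [mul_assoc, W.utu.reassoc₃, W.ua.reassoc]
  have h₄ : u * (t * (a * L * s * b * p * a)) * u = s * L * a * u := by
    trans u * t * a * r * s * b * u * τ * p * a
    · refine eq_of_forall_mul_eq fun w => ?_
      simp only [mul_assoc, W.aL.reassoc, W.sτ.symm.reassoc, W.bτ.symm.reassoc, W.uτ.reassoc,
        W.up.reassoc, W.ua.reassoc]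
    · rw [h_core]
      refine eq_of_forall_mul_eq fun w => ?_
      simp only [mul_assoc, W.La.reassoc, W.sτ.reassoc, W.sr.reassoc, W.sa.reassoc, W.uτ.reassoc,
        W.up.reassoc, W.ua.reassoc]
  have h₅ : u * (t * (t * a * p * b * s * L * a * t)) * u = a * L * s * u := by
    rw [h_sym]
    refine eq_of_forall_mul_eq fun w => ?_
    simp only [mul_assoc, W.tt.reassoc, one_mul, W.tu.reassoc]
    simp only [W.pap.reassoc₃]
    simp only [mul_assoc, W.ua.reassoc, W.uL.reassoc, W.us.reassoc, W.ubp.reassoc₃, W.tp.reassoc,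
      W.tt.reassoc, one_mul]
  simp only [nextL, nextTau, mul_add, mul_sub, add_mul, sub_mul, neg_mul]
  rw [h₁, h₂, h₃, h₄, h₅]
  abel

theorem u_nextTau_u (W : MurphyPair s t a b r p u L τ) {Z M : A} (h : p * τ * p = Z * p - M * p)
    (hsZ : s * Z = Z * s) (htZ : t * Z = Z * t) (htM : t * M = M * t) :
    u * nextTau s t a b p L τ * u
      = (Z - (-(L * a) - a * L + a * L * r * a + s * M * s + τ)) * u := by
  have h₁ : u * (s * t * τ * t * s) * u = Z * u - s * M * s * u := by
    trans s * t * (p * τ * p) * t * s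
    · trans s * u * t * τ * t * u * s
      · refine eq_of_forall_mul_eq fun w => ?_
        simp only [mul_assoc, W.us.reassoc]
      · refine eq_of_forall_mul_eq fun w => ?_
        simp only [mul_assoc, W.tp.symm.reassoc, W.tu.reassoc]
    · rw [h, mul_sub, sub_mul, sub_mul]
      congr 1
      · refine eq_of_forall_mul_eq fun w => ?_
        simp only [mul_assoc, htZ.reassoc, hsZ.reassoc, W.tp.reassoc, W.tt.reassoc, one_mul,
          W.us.reassoc, W.ss.reassoc]
      · refine eq_of_forall_mul_eq fun w => ?_
        simp only [mul_assoc, htM.reassoc, W.tp.reassoc, W.tt.reassoc, one_mul, W.us.reassoc]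
  have h₂ : u * (a * L * t * a * t) * u = a * L * u := by
    trans a * L * s * u * b * u * s
    · refine eq_of_forall_mul_eq fun w => ?_
      simp only [mul_assoc, W.ua.reassoc, W.uL.reassoc, W.tat.reassoc₃, W.us.reassoc]
    · refine eq_of_forall_mul_eq fun w => ?_
      simp only [mul_assoc, W.ubu.reassoc₃, W.us.reassoc, W.ss.reassoc, one_mul]
  have h₃ : u * (t * a * L * t * a) * u = L * a * u := by
    trans s * u * b * u * s * L * a
    · refine eq_of_forall_mul_eq fun w => ?_
      simp only [mul_assoc, W.tL.symm.reassoc, W.tat.reassoc₃, W.us.reassoc, W.uL.reassoc,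
        W.ua.reassoc]
    · refine eq_of_forall_mul_eq fun w => ?_
      simp only [mul_assoc, W.ubu.reassoc₃, W.us.reassoc, W.uL.reassoc, W.ua.reassoc, W.ss.reassoc,
        one_mul]
  have h₄ : u * (a * L * s * b * p * a) * u = a * L * r * a * u := by
    trans a * L * s * u * b * u * p * a
    · refine eq_of_forall_mul_eq fun w => ?_
      simp only [mul_assoc, W.ua.reassoc, W.uL.reassoc, W.us.reassoc, W.up.reassoc]
    · refine eq_of_forall_mul_eq fun w => ?_
      simp only [mul_assoc, W.ubu.reassoc₃, W.up.reassoc, W.ua.reassoc, W.sp.reassoc, W.sa.reassoc]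
  have h₅ : u * (t * a * p * b * s * L * a * t) * u = τ * u := by
    trans t * (p * b * s * L * a * p) * t
    · refine eq_of_forall_mul_eq fun w => ?_
      simp only [mul_assoc, W.tp.symm.reassoc, W.tu.reassoc, W.pap.reassoc₃]
    · rw [W.pbsLap]
      refine eq_of_forall_mul_eq fun w => ?_
      simp only [mul_assoc, W.tt.reassoc, one_mul, W.tp.reassoc]
  simp only [nextTau, mul_add, mul_sub, add_mul, sub_mul, neg_mul]
  rw [h₁, h₂, h₃, h₄, h₅]
  abel

theorem nextTau_comm (W : MurphyPair s t a b r p u L τ) {c v : A}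
    (hcs : c * s = s * c) (hca : c * a = a * c)
    (hcr : c * r = r * c) (hcp : c * p = p * c) (hcb : c * b = b * c) (hcL : c * L = L * c)
    (hvs : v * s = s * v) (hva : v * a = a * v) (hvL : v * L = L * v) (hvτ : v * τ = τ * v)
    (h_tct : t * c * t = v * b * v) :
    c * nextTau s t a b p L τ = nextTau s t a b p L τ * c := by
  obtain ⟨d, h_d⟩ : ∃ d, d = t * c * t := ⟨_, rfl⟩
  obtain ⟨e, h_e⟩ : ∃ e, e = s * d * s := ⟨_, rfl⟩
  have hct : c * t = t * d := by
    rw [h_d]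
    refine eq_of_forall_mul_eq fun w => ?_
    simp only [mul_assoc, W.tt.reassoc, one_mul]
  have hdt : d * t = t * c := by
    rw [h_d]
    refine eq_of_forall_mul_eq fun w => ?_
    simp only [mul_assoc, W.tt.reassoc, one_mul]
  have hda : d * a = a * d := by
    rw [h_d, h_tct]
    refine eq_of_forall_mul_eq fun w => ?_
    simp only [mul_assoc, hva.reassoc, W.ba.reassoc]
  have hdL : d * L = L * d := by
    rw [h_d, h_tct]
    refine eq_of_forall_mul_eq fun w => ?_
    simp only [mul_assoc, hvL.reassoc, W.bL.reassoc]
  have hdτ : d * τ = τ * d := by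
    rw [h_d, h_tct]
    refine eq_of_forall_mul_eq fun w => ?_
    simp only [mul_assoc, hvτ.reassoc, W.bτ.reassoc]
  have hdr : d * r = r * d := by
    rw [h_d]
    refine eq_of_forall_mul_eq fun w => ?_
    simp only [mul_assoc, W.tr.reassoc, hcr.reassoc]
  have hde : d * a = a * e := by
    rw [h_e, h_d, h_tct]
    refine eq_of_forall_mul_eq fun w => ?_
    simp only [mul_assoc, hva.reassoc, W.ba.reassoc]
    simp only [W.as.reassoc]
    simp only [mul_assoc, hvs.reassoc, hva.symm.reassoc, W.ba.symm.reassoc]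
    simp only [W.as.reassoc]
    simp only [mul_assoc, hva.reassoc]
  have hep : e * p = p * e := by
    rw [h_e]
    refine eq_of_forall_mul_eq fun w => ?_
    simp only [mul_assoc, W.sp.reassoc, hdr.reassoc, W.sr.reassoc]
  have heb : e * b = b * e := by
    rw [h_e, h_d]
    refine eq_of_forall_mul_eq fun w => ?_
    simp only [mul_assoc, W.tsb.reassoc₃, W.bst.reassoc₃, hca.reassoc]
  have hes : e * s = s * d := by
    rw [h_e]
    refine eq_of_forall_mul_eq fun w => ?_
    simp only [mul_assoc, W.ss.reassoc, one_mul]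
  have h₁ : c * (s * t * τ * t * s) = s * t * τ * t * s * c := by
    refine eq_of_forall_mul_eq fun w => ?_
    simp only [mul_assoc, hcs.reassoc, hct.reassoc, hdτ.reassoc, hdt.reassoc]
  have h₂ : c * (a * L * t * a * t) = a * L * t * a * t * c := by
    refine eq_of_forall_mul_eq fun w => ?_
    simp only [mul_assoc, hca.reassoc, hcL.reassoc, hct.reassoc, hda.reassoc, hdt.reassoc]
  have h₃ : c * (t * a * L * t * a) = t * a * L * t * a * c := by
    refine eq_of_forall_mul_eq fun w => ?_
    simp only [mul_assoc, hct.reassoc, hda.reassoc, hdL.reassoc, hdt.reassoc, hca.reassoc]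
  have h₄ : c * (a * L * s * b * p * a) = a * L * s * b * p * a * c := by
    refine eq_of_forall_mul_eq fun w => ?_
    simp only [mul_assoc, hca.reassoc, hcL.reassoc, hcs.reassoc, hcb.reassoc, hcp.reassoc]
  have h₅ : c * (t * a * p * b * s * L * a * t) = t * a * p * b * s * L * a * t * c := by
    trans t * a * e * p * b * s * L * a * t
    · refine eq_of_forall_mul_eq fun w => ?_
      simp only [mul_assoc, hct.reassoc, hde.reassoc]
    · refine eq_of_forall_mul_eq fun w => ?_
      simp only [mul_assoc, hep.reassoc, heb.reassoc, hes.reassoc, hdL.reassoc, hda.reassoc,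
        hdt.reassoc]
  simp only [nextTau, mul_add, mul_sub, add_mul, sub_mul]
  rw [h₁, h₂, h₃, h₄, h₅]

end MurphyPair

end Words

namespace PartitionAlgebra

variable {k : ℕ} {A : Type*} [Ring A] [Algebra (Polynomial ℤ) A]

theorem threeStrand (P : PartitionAlgebra k A) (n : ℕ) (hn : n + 3 ≤ k) :
    ThreeStrand (P.s (n + 1)) (P.s (n + 2)) (P.q (n + 1)) (P.q (n + 2))
      (P.p (n + 1)) (P.p (n + 2)) (P.p (n + 3)) := by
  have ss := P.s_sq (n + 1) (by omega) (by omega)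
  have tt := P.s_sq (n + 2) (by omega) (by omega)
  have srs := P.sps (n + 1) (by omega) (by omega)
  have tpt := P.sps (n + 2) (by omega) (by omega)
  exact
    { ss := ss
      tt := tt
      sts := P.braid (n + 1) (by omega) (by omega)
      sa := P.s_q (n + 1) (by omega) (by omega)
      as := P.q_s (n + 1) (by omega) (by omega)
      tb := P.s_q (n + 2) (by omega) (by omega)
      bt := P.q_s (n + 2) (by omega) (by omega)
      ba := P.q_comm _ _ (by omega) (by omega) (by omega) (by omega)
      sr := by rw [← srs, mul_assoc, ss, mul_one]
      sp := by rw [← srs, ← mul_assoc, ← mul_assoc, ss, one_mul]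
      tp := by rw [← tpt, mul_assoc, tt, mul_one]
      tu := by rw [← tpt, ← mul_assoc, ← mul_assoc, tt, one_mul]
      tr := P.s_p _ _ (by omega) (by omega) (by omega) (by omega) (by omega) (by omega)
      us := (P.s_p _ _ (by omega) (by omega) (by omega) (by omega) (by omega) (by omega)).symm
      ua := (P.q_p _ _ (by omega) (by omega) (by omega) (by omega) (by omega) (by omega)).symm
      up := P.p_comm _ _ (by omega) (by omega) (by omega) (by omega)
      br := P.q_p _ _ (by omega) (by omega) (by omega) (by omega) (by omega) (by omega)
      tpu := by rw [mul_assoc]; exact P.s_pp (n + 2) (by omega) (by omega)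
      tat := P.sqs (n + 2) (by omega) (by omega)
      apa := P.qpq₂ (n + 1) (by omega) (by omega)
      bpb := P.qpq₁ (n + 2) (by omega) (by omega)
      pap := P.pqp₁ (n + 2) (by omega) (by omega)
      pbp := P.pqp₂ (n + 2) (by omega) (by omega)
      ubu := P.pqp₁ (n + 3) (by omega) (by omega) }

theorem sigH_add_two (P : PartitionAlgebra k A) (n : ℕ) :
    P.sigH (n + 2) = nextTau (P.s (n + 1)) (P.s (n + 2)) (P.q (n + 1)) (P.q (n + 2))
      (P.p (n + 2)) (P.L (n + 1)) (P.sigH (n + 1)) := rfl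

theorem sig_add_three (P : PartitionAlgebra k A) (n : ℕ) :
    P.sig (n + 3) =
      P.s (n + 1) * P.s (n + 2) * P.sig (n + 2) * P.s (n + 2) * P.s (n + 1)
        + P.s (n + 2) * P.q (n + 1) * P.L (n + 1) * P.s (n + 2) * P.q (n + 1) * P.s (n + 2)
        + P.q (n + 1) * P.L (n + 1) * P.s (n + 2) * P.q (n + 1)
        - P.s (n + 2) * P.q (n + 1) * P.L (n + 1) * P.s (n + 1) * P.q (n + 2) * P.p (n + 2)
            * P.q (n + 1)
        - P.q (n + 1) * P.p (n + 2) * P.q (n + 2) * P.s (n + 1) * P.L (n + 1) * P.q (n + 1)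
            * P.s (n + 2) := rfl

theorem sig_add_two (P : PartitionAlgebra k A) (n : ℕ) (hn : n + 2 ≤ k) :
    P.sig (n + 2) = P.s (n + 1) * P.sigH (n + 1) := by
  induction n with
  | zero => simp [sig, LS, sigH, LSh]
  | succ n ih =>
    have W := P.threeStrand n (by omega)
    rw [sig_add_three, sigH_add_two, ih (by omega), nextTau]
    refine eq_of_forall_mul_eq fun w => ?_
    simp only [add_mul, sub_mul, mul_add, mul_sub, mul_assoc, W.tt.reassoc, one_mul,
      W.sts.reassoc₃]

theorem L_add_two_eq_sig (P : PartitionAlgebra k A) (n : ℕ) :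
    P.L (n + 2) = -(P.s (n + 1) * P.L (n + 1) * P.q (n + 1))
      - P.q (n + 1) * P.L (n + 1) * P.s (n + 1)
      + P.q (n + 1) * P.L (n + 1) * P.p (n + 2) * P.q (n + 1)
      + P.s (n + 1) * P.L (n + 1) * P.s (n + 1) + P.sig (n + 2) := rfl

theorem L_add_two (P : PartitionAlgebra k A) (n : ℕ) (hn : n + 2 ≤ k) :
    P.L (n + 2) = nextL (P.s (n + 1)) (P.q (n + 1)) (P.p (n + 2)) (P.L (n + 1))
      (P.sigH (n + 1)) := by
  rw [nextL, ← P.sig_add_two n hn, L_add_two_eq_sig]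

theorem Lh_succ (P : PartitionAlgebra k A) (n : ℕ) :
    P.Lh (n + 1) = -(P.L (n + 1) * P.q (n + 1)) - P.q (n + 1) * P.L (n + 1)
      + P.q (n + 1) * P.L (n + 1) * P.p (n + 1) * P.q (n + 1)
      + P.s (n + 1) * P.Lh n * P.s (n + 1) + P.sigH (n + 1) := by
  cases n <;> rfl

theorem L_mem_and_sig_mem (P : PartitionAlgebra k A) (S : Subring A) : ∀ n : ℕ,
    (∀ l, 1 ≤ l → l < n → P.s l ∈ S) → (∀ l, 1 ≤ l → l < n → P.q l ∈ S) →
    (∀ l, 1 ≤ l → l ≤ n → P.p l ∈ S) → P.L n ∈ S ∧ P.sig n ∈ S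
  | 0, _, _, _ => ⟨S.zero_mem, S.one_mem⟩
  | 1, _, _, hp => ⟨hp 1 le_rfl le_rfl, S.one_mem⟩
  | n + 2, hs, hq, hp => by
    obtain ⟨hL, h_sig⟩ := L_mem_and_sig_mem P S (n + 1) (fun l _ _ => hs l (by omega) (by omega))
      (fun l _ _ => hq l (by omega) (by omega)) (fun l _ _ => hp l (by omega) (by omega))
    obtain ⟨hL₀, -⟩ := L_mem_and_sig_mem P S n (fun l _ _ => hs l (by omega) (by omega))
      (fun l _ _ => hq l (by omega) (by omega)) (fun l _ _ => hp l (by omega) (by omega))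
    have hs₁ := hs (n + 1) (by omega) (by omega)
    have hq₁ := hq (n + 1) (by omega) (by omega)
    have hp₁ := hp (n + 1) (by omega) (by omega)
    have hp₂ := hp (n + 2) (by omega) (by omega)
    have h : P.sig (n + 2) ∈ S := by
      cases n with
      | zero => exact hs₁
      | succ n =>
        have hs₀ := hs (n + 1) (by omega) (by omega)
        have hq₀ := hq (n + 1) (by omega) (by omega)
        rw [sig_add_three]
        repeat' first | assumption | apply S.add_mem | apply S.sub_mem | apply S.mul_mem
    refine ⟨?_, h⟩
    rw [L_add_two_eq_sig]
    repeat' first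
      | assumption | apply S.add_mem | apply S.sub_mem | apply S.mul_mem | apply S.neg_mem

theorem Lh_mem_and_sigH_mem (P : PartitionAlgebra k A) (S : Subring A) : ∀ n : ℕ,
    (∀ l, 1 ≤ l → l ≤ n → P.s l ∈ S) → (∀ l, 1 ≤ l → l ≤ n → P.q l ∈ S) →
    (∀ l, 1 ≤ l → l ≤ n → P.p l ∈ S) → P.Lh n ∈ S ∧ P.sigH n ∈ S
  | 0, _, _, _ => ⟨S.zero_mem, S.one_mem⟩
  | n + 1, hs, hq, hp => by
    obtain ⟨hM, h_tau⟩ := Lh_mem_and_sigH_mem P S n (fun l _ _ => hs l (by omega) (by omega))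
      (fun l _ _ => hq l (by omega) (by omega)) (fun l _ _ => hp l (by omega) (by omega))
    obtain ⟨hL, -⟩ := P.L_mem_and_sig_mem S (n + 1) (fun l _ _ => hs l (by omega) (by omega))
      (fun l _ _ => hq l (by omega) (by omega)) hp
    have hs₁ := hs (n + 1) (by omega) (by omega)
    have hq₁ := hq (n + 1) (by omega) (by omega)
    have hp₁ := hp (n + 1) (by omega) (by omega)
    have h : P.sigH (n + 1) ∈ S := by
      cases n with
      | zero => exact S.one_mem
      | succ n =>
        obtain ⟨hL₀, -⟩ := P.L_mem_and_sig_mem S (n + 1)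
          (fun l _ _ => hs l (by omega) (by omega)) (fun l _ _ => hq l (by omega) (by omega))
          (fun l _ _ => hp l (by omega) (by omega))
        have hs₀ := hs (n + 1) (by omega) (by omega)
        have hq₀ := hq (n + 1) (by omega) (by omega)
        rw [sigH_add_two, nextTau]
        repeat' first | assumption | apply S.add_mem | apply S.sub_mem | apply S.mul_mem
    refine ⟨?_, h⟩
    rw [Lh_succ]
    repeat' first
      | assumption | apply S.add_mem | apply S.sub_mem | apply S.mul_mem | apply S.neg_mem

theorem commute_L (P : PartitionAlgebra k A) {x : A} {n : ℕ}
    (hs : ∀ l, 1 ≤ l → l < n → x * P.s l = P.s l * x)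
    (hq : ∀ l, 1 ≤ l → l < n → x * P.q l = P.q l * x)
    (hp : ∀ l, 1 ≤ l → l ≤ n → x * P.p l = P.p l * x) : x * P.L n = P.L n * x := by
  have h := (P.L_mem_and_sig_mem (Subring.centralizer {x}) n)
  simp only [Subring.mem_centralizer_iff, Set.mem_singleton_iff, forall_eq] at h
  exact (h hs hq hp).1

theorem commute_Lh_and_sigH (P : PartitionAlgebra k A) {x : A} {n : ℕ}
    (hs : ∀ l, 1 ≤ l → l ≤ n → x * P.s l = P.s l * x)
    (hq : ∀ l, 1 ≤ l → l ≤ n → x * P.q l = P.q l * x)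
    (hp : ∀ l, 1 ≤ l → l ≤ n → x * P.p l = P.p l * x) :
    x * P.Lh n = P.Lh n * x ∧ x * P.sigH n = P.sigH n * x := by
  have h := (P.Lh_mem_and_sigH_mem (Subring.centralizer {x}) n)
  simp only [Subring.mem_centralizer_iff, Set.mem_singleton_iff, forall_eq] at h
  exact h hs hq hp

theorem s_mul_L (P : PartitionAlgebra k A) {i n : ℕ} (hn : n < i) (hi : i + 1 ≤ k) :
    P.s i * P.L n = P.L n * P.s i :=
  P.commute_L (fun l _ _ => P.s_comm _ _ (by omega) (by omega) (by omega) (by omega)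
      (by omega) (by omega))
    (fun l _ _ => P.s_q' _ _ (by omega) (by omega) (by omega) (by omega) (by omega) (by omega))
    (fun l _ _ => P.s_p _ _ (by omega) (by omega) (by omega) (by omega) (by omega) (by omega))

theorem q_mul_L (P : PartitionAlgebra k A) {i n : ℕ} (hn : n < i) (hi : i + 1 ≤ k) :
    P.q i * P.L n = P.L n * P.q i :=
  P.commute_L (fun l _ _ => (P.s_q' _ _ (by omega) (by omega) (by omega) (by omega)
      (by omega) (by omega)).symm)
    (fun l _ _ => P.q_comm _ _ (by omega) (by omega) (by omega) (by omega))
    (fun l _ _ => P.q_p _ _ (by omega) (by omega) (by omega) (by omega) (by omega) (by omega))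

theorem p_mul_L (P : PartitionAlgebra k A) {i n : ℕ} (hn : n < i) (hi : i ≤ k) :
    P.p i * P.L n = P.L n * P.p i :=
  P.commute_L (fun l _ _ => (P.s_p _ _ (by omega) (by omega) (by omega) (by omega)
      (by omega) (by omega)).symm)
    (fun l _ _ => (P.q_p _ _ (by omega) (by omega) (by omega) (by omega)
      (by omega) (by omega)).symm)
    (fun l _ _ => P.p_comm _ _ (by omega) (by omega) (by omega) (by omega))

theorem s_mul_Lh_and_sigH (P : PartitionAlgebra k A) {i n : ℕ} (hn : n + 1 < i)
    (hi : i + 1 ≤ k) :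
    P.s i * P.Lh n = P.Lh n * P.s i ∧ P.s i * P.sigH n = P.sigH n * P.s i :=
  P.commute_Lh_and_sigH (fun l _ _ => P.s_comm _ _ (by omega) (by omega) (by omega) (by omega)
      (by omega) (by omega))
    (fun l _ _ => P.s_q' _ _ (by omega) (by omega) (by omega) (by omega) (by omega) (by omega))
    (fun l _ _ => P.s_p _ _ (by omega) (by omega) (by omega) (by omega) (by omega) (by omega))

theorem p_mul_sigH (P : PartitionAlgebra k A) {i n : ℕ} (hn : n + 1 < i) (hi : i ≤ k) :
    P.p i * P.sigH n = P.sigH n * P.p i :=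
  (P.commute_Lh_and_sigH (fun l _ _ => (P.s_p _ _ (by omega) (by omega) (by omega) (by omega)
      (by omega) (by omega)).symm)
    (fun l _ _ => (P.q_p _ _ (by omega) (by omega) (by omega) (by omega)
      (by omega) (by omega)).symm)
    (fun l _ _ => P.p_comm _ _ (by omega) (by omega) (by omega) (by omega))).2

theorem sigH_one (P : PartitionAlgebra k A) : P.sigH 1 = 1 := rfl

theorem L_one (P : PartitionAlgebra k A) : P.L 1 = P.p 1 := rfl

theorem murphyPair (P : PartitionAlgebra k A) (n : ℕ) (hn : n + 3 ≤ k) :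
    MurphyPair (P.s (n + 1)) (P.s (n + 2)) (P.q (n + 1)) (P.q (n + 2))
      (P.p (n + 1)) (P.p (n + 2)) (P.p (n + 3)) (P.L (n + 1)) (P.sigH (n + 1)) := by
  induction n with
  | zero =>
    exact
      { P.threeStrand 0 hn with
        tL := P.s_mul_L (by omega) (by omega)
        bL := P.q_mul_L (by omega) (by omega)
        pL := P.p_mul_L (by omega) (by omega)
        uL := P.p_mul_L (by omega) (by omega)
        uτ := P.p_mul_sigH (by omega) (by omega)
        sτ := by rw [sigH_one, mul_one, one_mul]
        bτ := by rw [sigH_one, mul_one, one_mul]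
        La := by rw [sigH_one, one_mul, L_one]
        aL := by rw [sigH_one, mul_one, L_one]
        aτ := by rw [sigH_one, mul_one]
        τa := by rw [sigH_one, one_mul] }
  | succ n ih =>
    have W := ih (by omega)
    exact
      { P.threeStrand (n + 1) hn with
        tL := P.s_mul_L (by omega) (by omega)
        bL := P.q_mul_L (by omega) (by omega)
        pL := P.p_mul_L (by omega) (by omega)
        uL := P.p_mul_L (by omega) (by omega)
        uτ := P.p_mul_sigH (by omega) (by omega)
        sτ := W.t_mul_nextTau
        bτ := W.nextTau_comm (v := P.s (n + 3))
          (P.s_q' _ _ (by omega) (by omega) (by omega) (by omega) (by omega) (by omega)).symm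
          (P.q_comm _ _ (by omega) (by omega) (by omega) (by omega))
          (P.q_p _ _ (by omega) (by omega) (by omega) (by omega) (by omega) (by omega))
          (P.q_p _ _ (by omega) (by omega) (by omega) (by omega) (by omega) (by omega))
          (P.q_comm _ _ (by omega) (by omega) (by omega) (by omega))
          (P.q_mul_L (by omega) (by omega))
          (P.s_comm _ _ (by omega) (by omega) (by omega) (by omega) (by omega) (by omega))
          (P.s_q' _ _ (by omega) (by omega) (by omega) (by omega) (by omega) (by omega))
          (P.s_mul_L (by omega) (by omega))
          (P.s_mul_Lh_and_sigH (by omega) (by omega)).2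
          (P.sqs (n + 3) (by omega) (by omega)).symm
        La := by rw [P.L_add_two n (by omega)]; exact W.nextL_mul_b
        aL := by rw [P.L_add_two n (by omega)]; exact W.b_mul_nextL
        aτ := W.b_mul_nextTau
        τa := W.nextTau_mul_b }

theorem p_s_sigH_p (P : PartitionAlgebra k A) (n : ℕ) (hn : n + 2 ≤ k) :
    P.p (n + 2) * (P.s (n + 1) * P.sigH (n + 1)) * P.p (n + 2) = P.L (n + 1) * P.p (n + 2) := by
  induction n with
  | zero =>
    have ss := P.s_sq 1 (by omega) (by omega)
    have sps := P.sps 1 (by omega) (by omega)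
    have spp := P.s_pp 1 (by omega) (by omega)
    calc P.p 2 * (P.s 1 * P.sigH 1) * P.p 2 = P.s 1 * P.p 1 * (P.s 1 * P.s 1) * P.p 2 := by
          rw [sigH_one, mul_one]; nth_rw 1 [← sps]; simp only [mul_assoc]
      _ = P.L 1 * P.p 2 := by rw [ss, mul_one, mul_assoc, spp, L_one]
  | succ n ih =>
    have W := P.murphyPair n (by omega)
    rw [P.L_add_two n (by omega)]
    exact W.u_t_nextTau_u (by rw [← ih (by omega)]; simp only [mul_assoc])

theorem p_sigH_p (P : PartitionAlgebra k A) (n : ℕ) (hn : n + 2 ≤ k) :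
    P.p (n + 2) * P.sigH (n + 1) * P.p (n + 2)
      = ((X : Polynomial ℤ) • (1 : A) - P.Lh n) * P.p (n + 2) := by
  induction n with
  | zero =>
    have h : P.Lh 0 = 0 := rfl
    rw [sigH_one, mul_one, h, sub_zero, smul_mul_assoc, one_mul]
    exact P.p_sq 2 (by omega) (by omega)
  | succ n ih =>
    have W := P.murphyPair n (by omega)
    rw [Lh_succ]
    exact W.u_nextTau_u (by rw [← sub_mul]; exact ih (by omega)) (by simp) (by simp)
      (P.s_mul_Lh_and_sigH (by omega) (by omega)).1

end PartitionAlgebra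

/-- Proposition 4.3: `p_{i+1} σ_{i+1} p_{i+1} = L_i p_{i+1}`,
`p_{i+1} σ_{i+1/2} p_{i+1} = (z - L_{i-1/2}) p_{i+1}` for `1 ≤ i ≤ k-1`, and
`p_{i+3/2} σ_{i+1} p_{i+3/2} = p_{i+1/2} p_{i+3/2}` for `1 ≤ i ≤ k-2`. -/
theorem partitionAlgebra_p_sig_p {k : ℕ} {A : Type*} [Ring A]
    [Algebra (Polynomial ℤ) A] (P : PartitionAlgebra k A) :
    (∀ i, 1 ≤ i → i ≤ k - 1 →
      P.p (i + 1) * P.sig (i + 1) * P.p (i + 1) = P.L i * P.p (i + 1) ∧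
      P.p (i + 1) * P.sigH i * P.p (i + 1) =
        ((X : Polynomial ℤ) • (1 : A) - P.Lh (i - 1)) * P.p (i + 1)) ∧
    (∀ i, 1 ≤ i → i ≤ k - 2 →
      P.q (i + 1) * P.sig (i + 1) * P.q (i + 1) = P.q i * P.q (i + 1)) := by
  constructor
  · intro i h₁ hk
    obtain ⟨n, rfl⟩ : ∃ n, i = n + 1 := ⟨i - 1, by omega⟩
    rw [P.sig_add_two n (by omega)]
    exact ⟨P.p_s_sigH_p n (by omega), P.p_sigH_p n (by omega)⟩
  · intro i h₁ hk
    obtain ⟨n, rfl⟩ : ∃ n, i = n + 1 := ⟨i - 1, by omega⟩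
    have W := P.murphyPair n (by omega)
    rw [P.sig_add_two n (by omega), mul_assoc, mul_assoc, ← W.bτ, ← mul_assoc, ← mul_assoc,
      W.bsb, ← W.ba, mul_assoc, W.aτ]
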